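/- Let v ≡ 2 (mod 4) and let F_1, ..., F_t be bipartite 2-regular graphs of order v with nonnegative even multiplicities α_1, ..., α_t satisfying α_1 + ... + α_t = (v-2)/2. Then K_v - I admits a 2-factorization containing exactly α_i factors isomorphic to F_i for each i. (This follows by doubling each Hamiltonian cycle of a Hamiltonian decomposition of K_{v/2} and applying Häggkvist's lemma.) -/

import Mathlib

/-- The vertex at position `x` of the `s`-th zigzag Hamiltonian cycle of `K_{2r+1}`. -/
def waleckiVertex (r s x : ℕ) : ℕ :=
  if x = 2 * r then 2 * r
  else if x % 2 = 1 then s + (x + 1) / 2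
  else if x / 2 ≤ s then s - x / 2 else s + 2 * r - x / 2

/-- The index of the zigzag Hamiltonian cycle of `K_{2r+1}` containing the edge `ab`. -/
def waleckiColor (r a b : ℕ) : ℕ :=
  if a = 2 * r then (if b < r then b else b - r)
  else if b = 2 * r then (if a < r then a else a - r)
  else if a + b < 2 * r then (a + b) / 2 else (a + b - 2 * r) / 2

theorem waleckiVertex_lt {r s x : ℕ} (hs : s < r) (hx : x < 2 * r + 1) :
    waleckiVertex r s x < 2 * r + 1 := by
  unfold waleckiVertex; split_ifs <;> omega

theorem waleckiVertex_injOn {r s x y : ℕ} (hs : s < r) (hx : x < 2 * r + 1)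
    (hy : y < 2 * r + 1) (h : waleckiVertex r s x = waleckiVertex r s y) : x = y := by
  unfold waleckiVertex at h; split_ifs at h <;> omega

theorem waleckiColor_comm (r a b : ℕ) : waleckiColor r a b = waleckiColor r b a := by
  unfold waleckiColor; split_ifs <;> omega

theorem waleckiColor_vertex_succ {r s x : ℕ} (hs : s < r) (hx : x < 2 * r) :
    waleckiColor r (waleckiVertex r s x) (waleckiVertex r s (x + 1)) = s := by
  unfold waleckiColor waleckiVertex; split_ifs <;> omega

theorem waleckiColor_vertex_last {r s : ℕ} (hs : s < r) :
    waleckiColor r (waleckiVertex r s (2 * r)) (waleckiVertex r s 0) = s := by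
  unfold waleckiColor waleckiVertex; split_ifs <;> omega

theorem val_finRotate (n : ℕ) (x : Fin (n + 1)) :
    (finRotate (n + 1) x : ℕ) = if (x : ℕ) = n then 0 else (x : ℕ) + 1 := by
  rw [coe_finRotate]
  simp [Fin.ext_iff]

theorem finRotate_finRotate_ne {n : ℕ} (hn : 2 ≤ n) (x : Fin (n + 1)) :
    finRotate (n + 1) (finRotate (n + 1) x) ≠ x := by
  intro h
  have h := congrArg Fin.val h
  have := x.isLt
  simp only [val_finRotate] at h
  split_ifs at h <;> omega

/-- `K_{2r+1}` decomposes into `r` Hamiltonian cycles; `h s a` is the position of the vertex `a`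
on the `s`-th cycle. -/
theorem exists_hamiltonian_decomposition (r : ℕ) :
    ∃ h : Fin r → Equiv.Perm (Fin (2 * r + 1)), ∀ a b, a ≠ b →
      ∃! s, finRotate _ (h s a) = h s b ∨ finRotate _ (h s b) = h s a := by
  let z (s : Fin r) (x : Fin (2 * r + 1)) : Fin (2 * r + 1) :=
    ⟨waleckiVertex r s x, waleckiVertex_lt s.isLt x.isLt⟩
  have hz (s) : Function.Injective (z s) := fun x y hxy =>
    Fin.ext (waleckiVertex_injOn s.isLt x.isLt y.isLt (congrArg Fin.val hxy))
  let e (s : Fin r) : Equiv.Perm (Fin (2 * r + 1)) :=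
    Equiv.ofBijective (z s) (Finite.injective_iff_bijective.1 (hz s))
  have hcol (s : Fin r) (x) : waleckiColor r (e s x) (e s (finRotate _ x)) = s := by
    change waleckiColor r (waleckiVertex r s x) (waleckiVertex r s (finRotate _ x : Fin _)) = s
    rw [val_finRotate]
    split_ifs with h
    · rw [h]; exact waleckiColor_vertex_last s.isLt
    · exact waleckiColor_vertex_succ s.isLt (by omega)
  have hcol' (s : Fin r) (a b)
      (h : finRotate _ ((e s).symm a) = (e s).symm b ∨ finRotate _ ((e s).symm b) = (e s).symm a) :
      waleckiColor r a b = s := by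
    rcases h with h | h
    · simpa [h] using hcol s ((e s).symm a)
    · rw [waleckiColor_comm]; simpa [h] using hcol s ((e s).symm b)
  refine ⟨fun s => (e s).symm, fun a b hab => ?_⟩
  have hr (s : Fin r) : 2 ≤ 2 * r := by have := s.isLt; omega
  have hne (s : Fin r) (x) : finRotate (2 * r + 1) x ≠ x := fun h =>
    finRotate_finRotate_ne (hr s) x (by rw [h, h])
  let φ (p : Fin r × Bool) : {b // b ≠ a} :=
    if p.2 then ⟨e p.1 (finRotate _ ((e p.1).symm a)), fun h => hne p.1 ((e p.1).symm a)
      ((Equiv.eq_symm_apply _).2 h)⟩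
    else ⟨e p.1 ((finRotate _).symm ((e p.1).symm a)), fun h => hne p.1 ((e p.1).symm a)
      (((Equiv.symm_apply_eq _).1 ((Equiv.eq_symm_apply _).2 h)).symm)⟩
  have hφ (p) : finRotate _ ((e p.1).symm a) = (e p.1).symm (φ p) ∨
      finRotate _ ((e p.1).symm (φ p)) = (e p.1).symm a := by
    rcases p with ⟨s, _ | _⟩ <;> simp [φ]
  have hinj : Function.Injective φ := by
    intro p q hpq
    have h1 := hcol' _ _ _ (hφ p)
    have h2 := hcol' _ _ _ (hφ q)
    rw [hpq, h2] at h1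
    rcases p with ⟨s, t⟩
    rcases q with ⟨s', t'⟩
    obtain rfl : s' = s := Fin.ext h1
    have key := finRotate_finRotate_ne (hr s') ((finRotate _).symm ((e s').symm a))
    rw [Equiv.apply_symm_apply] at key
    have hval := congrArg Subtype.val hpq
    rcases t with _ | _ <;> rcases t' with _ | _
    · rfl
    · exact (key ((e s').injective hval).symm).elim
    · exact (key ((e s').injective hval)).elim
    · rfl
  have hsurj : Function.Surjective φ := by
    refine ((Fintype.bijective_iff_injective_and_card φ).2 ⟨hinj, ?_⟩).2
    simp [mul_comm]
  obtain ⟨p, hp⟩ := hsurj ⟨b, hab.symm⟩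
  have hpb := hφ p
  rw [hp] at hpb
  refine ⟨p.1, hpb, fun s hs => Fin.ext ?_⟩
  rw [← hcol' s a b hs, ← hcol' p.1 a b hpb]

/-- The disjoint union of the boundaries of the ladders obtained by doubling the paths into which
the cycles of `c` are cut in front of the points marked by `st`. -/
def ladderBoundary {W : Type*} (c : Equiv.Perm W) (hc : ∀ x, c x ≠ x) (st : W → Bool) :
    SimpleGraph (W × Bool) where
  Adj p q :=
    (p.2 = q.2 ∧ ((c p.1 = q.1 ∧ st q.1 = false) ∨ (c q.1 = p.1 ∧ st p.1 = false))) ∨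
      (p.2 ≠ q.2 ∧ p.1 = q.1 ∧ (st p.1 = true ∨ st (c p.1) = true))
  symm := ⟨by
    rintro ⟨x, a⟩ ⟨y, b⟩ (⟨h1, h2⟩ | ⟨h1, h2, h3⟩)
    · exact Or.inl ⟨h1.symm, h2.symm⟩
    · simp only at h1 h2 h3
      subst h2
      exact Or.inr ⟨Ne.symm h1, rfl, h3⟩⟩
  loopless := ⟨fun _ h => h.elim (fun h => h.2.elim (fun h => hc _ h.1) (fun h => hc _ h.1))
    (fun h => h.1 rfl)⟩

/-- The factor containing the edge from `(x, a)` to `(c x, b)` in Häggkvist's decomposition. -/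
def haggkvistColor {W : Type*} (c : Equiv.Perm W) (st : W → Bool) (x : W) (a b : Bool) : Bool :=
  if st x then a else if st (c x) then !b else a == b

/-- The two factors of Häggkvist's decomposition of the doubling of the cycles of `c`. -/
def haggkvistFactor {W : Type*} (c : Equiv.Perm W) (hc : ∀ x, c x ≠ x) (st : W → Bool) (t : Bool) :
    SimpleGraph (W × Bool) where
  Adj p q := (c p.1 = q.1 ∧ haggkvistColor c st p.1 p.2 q.2 = t) ∨
    (c q.1 = p.1 ∧ haggkvistColor c st q.1 q.2 p.2 = t)
  symm := ⟨fun _ _ h => h.symm⟩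
  loopless := ⟨fun _ h => h.elim (fun h => hc _ h.1) (fun h => hc _ h.1)⟩

theorem nonempty_haggkvistFactor_iso {W : Type*} [Finite W] (c : Equiv.Perm W)
    (hc : ∀ x, c x ≠ x) (st par : W → Bool) (hst : ∀ x, st x = true → st (c x) = false)
    (hpar : ∀ x, st x = true → par x = true)
    (hpar' : ∀ x, st (c x) = false → par (c x) = !par x) (t : Bool) :
    Nonempty (haggkvistFactor c hc st t ≃g ladderBoundary c hc st) := by
  let g (x : W) : Bool := !t && par x
  let ψ (p : W × Bool) : W × Bool :=
    if p.2 then (p.1, !g p.1) else (c p.1, g (c p.1))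
  have hψ : Function.Injective ψ := by
    rintro ⟨x, _ | _⟩ ⟨y, _ | _⟩ h <;> simp [ψ] at h ⊢
    · exact h.1
    · have := h.2; rw [h.1] at this; simp at this
    · have := h.2; rw [h.1] at this; simp at this
    · exact h.1
  have h11 (x : W) : haggkvistColor c st x (!g x) (!g (c x)) = t ↔ st (c x) = false := by
    have := hst x; have := hpar x; have := hpar' x; have := hpar (c x)
    unfold haggkvistColor
    cases t <;> cases hx : st x <;> cases hy : st (c x) <;> cases hz : par x <;> simp_all [g]
  have h00 (x : W) : haggkvistColor c st x (g x) (g (c x)) = t ↔ st x = false := by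
    have := hst x; have := hpar x; have := hpar' x; have := hpar (c x)
    unfold haggkvistColor
    cases t <;> cases hx : st x <;> cases hy : st (c x) <;> cases hz : par x <;> simp_all [g]
  have h10 (x : W) : haggkvistColor c st x (!g x) (g (c x)) = t ↔
      (st x = true ∨ st (c x) = true) := by
    have := hst x; have := hpar x; have := hpar' x; have := hpar (c x)
    unfold haggkvistColor
    cases t <;> cases hx : st x <;> cases hy : st (c x) <;> cases hz : par x <;> simp_all [g]
  have h01 (x : W) : haggkvistColor c st x (g x) (!g (c x)) ≠ t := by
    have := hst x; have := hpar x; have := hpar' x; have := hpar (c x)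
    unfold haggkvistColor
    cases t <;> cases hx : st x <;> cases hy : st (c x) <;> cases hz : par x <;> simp_all [g]
  have h11' (x y : W) : (c x = y ∧ haggkvistColor c st x (!g x) (!g y) = t) ↔
      (c x = y ∧ st y = false) :=
    and_congr_right fun h => by subst h; exact h11 x
  have h00' (x y : W) : (c (c x) = c y ∧ haggkvistColor c st (c x) (g (c x)) (g (c y)) = t) ↔
      (c x = y ∧ st y = false) := by
    rw [c.apply_eq_iff_eq]
    exact and_congr_right fun h => by subst h; exact h00 _
  have h10' (x y : W) : (c x = c y ∧ haggkvistColor c st x (!g x) (g (c y)) = t) ↔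
      (x = y ∧ (st x = true ∨ st (c x) = true)) := by
    rw [c.apply_eq_iff_eq]
    exact and_congr_right fun h => by subst h; exact h10 _
  have h01' (x y : W) : ¬ (c (c x) = y ∧ haggkvistColor c st (c x) (g (c x)) (!g y) = t) := by
    rintro ⟨rfl, h⟩
    exact h01 _ h
  refine ⟨RelIso.symm ⟨Equiv.ofBijective ψ (Finite.injective_iff_bijective.1 hψ), ?_⟩⟩
  rintro ⟨x, _ | _⟩ ⟨y, _ | _⟩ <;>
    simp only [Equiv.ofBijective_apply, ψ, haggkvistFactor, ladderBoundary, Bool.false_eq_true,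
      if_false, if_true, h11', h00', h10', h01', or_false, false_or, true_and, false_and, ne_eq,
      not_true, not_false_iff, reduceCtorEq]
  constructor <;> rintro ⟨rfl, h⟩ <;> exact ⟨rfl, h⟩

theorem exists_injective_adj_of_two_regular {V : Type*} [Finite V] (F : SimpleGraph V)
    (h2 : ∀ x, (F.neighborSet x).ncard = 2) :
    ∃ f : V → V, Function.Injective f ∧ ∀ x, F.Adj x (f x) := by
  classical
  cases nonempty_fintype V
  have hdeg (x : V) : (F.neighborFinset x).card = 2 := by
    rw [← h2 x, ← Set.ncard_coe_finset, SimpleGraph.coe_neighborFinset]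
  obtain ⟨f, hf, hfF⟩ := (Finset.all_card_le_biUnion_card_iff_exists_injective
    (fun x => F.neighborFinset x)).1 fun s => by
      have := Finset.card_mul_le_card_mul (s := s) (t := s.biUnion fun x => F.neighborFinset x)
        F.Adj (m := 2) (n := 2)
        (fun a ha => by
          rw [← hdeg a]
          refine Finset.card_le_card fun y hy => ?_
          rw [Finset.mem_bipartiteAbove]
          exact ⟨Finset.mem_biUnion.2 ⟨a, ha, hy⟩, by simpa using hy⟩)
        (fun b _ => by
          rw [← hdeg b]
          refine Finset.card_le_card fun y hy => ?_
          rw [Finset.mem_bipartiteBelow] at hy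
          simpa using hy.2.symm)
      omega
  exact ⟨f, hf, fun x => by simpa using hfF x⟩

/-- A finite bipartite 2-regular graph is the graph of a permutation that alternates between the
two parts and has no 2-cycles. -/
theorem exists_perm_of_two_regular {V : Type*} [Finite V] (F : SimpleGraph V)
    (h2 : ∀ x, (F.neighborSet x).ncard = 2) (hbip : F.Colorable 2) :
    ∃ (ρ : Equiv.Perm V) (col : V → Bool), (∀ x y, F.Adj x y ↔ ρ x = y ∨ ρ y = x) ∧
      (∀ x, col (ρ x) = !col x) ∧ ∀ x, ρ (ρ x) ≠ x := by
  obtain ⟨C⟩ := hbip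
  let col (x : V) : Bool := decide (C x = 0)
  have hcol {x y} (h : F.Adj x y) : col y = !col x := by
    have := C.valid h
    rw [← decide_not, decide_eq_decide]
    omega
  obtain ⟨f, hf, hfF⟩ := exists_injective_adj_of_two_regular F h2
  have hfs := Finite.surjective_of_injective hf
  have hother (x y) (h : F.Adj x y) : ∃ z, z ≠ y ∧ F.Adj x z ∧ ∀ w, F.Adj x w → w = y ∨ w = z := by
    obtain ⟨a, b, hab, hs⟩ := Set.ncard_eq_two.1 (h2 x)
    have hmem (w) : F.Adj x w ↔ w = a ∨ w = b := by
      rw [← SimpleGraph.mem_neighborSet, hs]; simp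
    rcases (hmem y).1 h with rfl | rfl
    · exact ⟨b, hab.symm, (hmem b).2 (Or.inr rfl), fun w hw => (hmem w).1 hw⟩
    · exact ⟨a, hab, (hmem a).2 (Or.inl rfl), fun w hw => ((hmem w).1 hw).symm⟩
  have hex (x) : ∃ z, F.Adj x z ∧ (col x = true → z = f x) ∧
      (col x = false → f z ≠ x ∧ ∀ w, F.Adj x w → f w = x ∨ w = z) := by
    cases hx : col x
    · obtain ⟨y, rfl⟩ := hfs x
      obtain ⟨z, hzy, hz, hw⟩ := hother _ _ (hfF y).symm
      exact ⟨z, hz, by simp, fun _ => ⟨hf.ne hzy, fun w h => (hw w h).imp_left (congrArg f)⟩⟩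
    · exact ⟨f x, hfF x, by simp⟩
  choose ρ hρ ht hff using hex
  have hinj : Function.Injective ρ := by
    intro x y hxy
    have hx := hcol (hρ x)
    have hy := hcol (hρ y)
    rw [hxy, hy] at hx
    have hxy' : col y = col x := by simpa using hx
    cases hcx : col x
    · rw [hcx] at hxy'
      have hx' := (hff x hcx).1
      have hy' := (hff y hxy').1
      rw [hxy] at hx'
      obtain ⟨z, -, -, hz⟩ := hother _ _ (hfF (ρ y))
      have h1 := hz x (hxy ▸ (hρ x).symm)
      have h2 := hz y (hρ y).symm
      grind
    · rw [hcx] at hxy'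
      exact hf (by rw [← ht x hcx, ← ht y hxy', hxy])
  refine ⟨Equiv.ofBijective ρ (Finite.injective_iff_bijective.1 hinj), col,
    fun x y => ⟨fun h => ?_, ?_⟩, fun x => hcol (hρ x), fun x => ?_⟩
  · have := hcol h
    simp only [Equiv.ofBijective_apply]
    cases hcx : col x
    · rw [hcx] at this
      have hy := ht y this
      rcases (hff x hcx).2 y h with h | h
      · exact Or.inr (hy.trans h)
      · exact Or.inl h.symm
    · rw [hcx] at this
      have hx := ht x hcx
      rcases (hff y this).2 x h.symm with h | h
      · exact Or.inl (hx.trans h)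
      · exact Or.inr h.symm
  · rintro (rfl | rfl)
    · exact hρ x
    · exact (hρ y).symm
  · simp only [Equiv.ofBijective_apply]
    have := hcol (hρ x)
    cases hcx : col x <;> rw [hcx] at this
    · rw [ht _ this]
      exact (hff x hcx).1
    · have h := (hff _ this).1
      rw [ht x hcx] at h ⊢
      intro h'
      rw [h'] at h
      exact h rfl

/-- A permutation with all cycles of even length at least 4 runs around a disjoint union of
ladders. -/
theorem exists_ladder_coordinates {V : Type*} [Finite V] (ρ : Equiv.Perm V) (col : V → Bool)
    (hcol : ∀ x, col (ρ x) = !col x) (hρ : ∀ x, ρ (ρ x) ≠ x) :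
    ∃ (k : ℕ) (m : Fin k → ℕ) (Φ : (Σ i, Fin (m i)) × Bool ≃ V), (∀ i, 2 ≤ m i) ∧
      (∀ i (j j' : Fin (m i)), (j' : ℕ) = j + 1 →
        ρ (Φ (⟨i, j⟩, true)) = Φ (⟨i, j'⟩, true) ∧ ρ (Φ (⟨i, j'⟩, false)) = Φ (⟨i, j⟩, false)) ∧
      (∀ i (j : Fin (m i)), (j : ℕ) + 1 = m i → ρ (Φ (⟨i, j⟩, true)) = Φ (⟨i, j⟩, false)) ∧
      (∀ i (j : Fin (m i)), (j : ℕ) = 0 → ρ (Φ (⟨i, j⟩, false)) = Φ (⟨i, j⟩, true)) := by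
  classical
  cases nonempty_fintype V
  let Q := Quotient (Equiv.Perm.SameCycle.setoid ρ)
  let q : Fin (Fintype.card Q) ≃ Q := (Fintype.equivFin Q).symm
  let o (i) : V := (q i).out
  have ho (x : V) : ∃ i, ρ.SameCycle (o i) x :=
    ⟨q.symm (Quotient.mk _ x), by
      simp only [o, Equiv.apply_symm_apply]
      exact Quotient.exact (s := Equiv.Perm.SameCycle.setoid ρ) (Quotient.out_eq _)⟩
  have ho' {i i'} (h : ρ.SameCycle (o i) (o i')) : i = i' := by
    have : (⟦(q i).out⟧ : Q) = ⟦(q i').out⟧ := Quotient.sound h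
    rw [Quotient.out_eq, Quotient.out_eq] at this
    exact q.injective this
  let P (x : V) : ℕ := Function.minimalPeriod ρ x
  have hP (x : V) (n : ℤ) : (ρ ^ n) x = x ↔ (P x : ℤ) ∣ n :=
    MulAction.zpow_smul_eq_iff_minimalPeriod_dvd (a := ρ) (b := x) (n := n)
  have hpos (x : V) : 0 < P x :=
    Function.minimalPeriod_pos_of_mem_periodicPts
      ((Function.Injective.mem_periodicPts ρ.injective x))
  have heven (x : V) : Even (P x) := by
    have hit (n : ℕ) : col (ρ^[n] x) = (col x ^^ decide (¬ Even n)) := by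
      induction n with
      | zero => simp
      | succ n ih =>
        rw [Function.iterate_succ_apply', hcol, ih]
        by_cases h : Even n <;> simp [h, Nat.even_add_one]
    have := hit (P x)
    rw [Function.iterate_minimalPeriod] at this
    by_contra h
    simp [h] at this
  have hfour (x : V) : 2 ≤ P x / 2 := by
    have h2 : P x ≠ 2 := fun h => hρ x (by
      have := (hP x 2).2 (by simp [h])
      rwa [show (2 : ℤ) = ((2 : ℕ) : ℤ) from rfl, zpow_natCast, pow_two] at this)
    have := hpos x
    obtain ⟨a, ha⟩ := heven x
    omega
  let m (i : Fin (Fintype.card Q)) : ℕ := P (o i) / 2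
  have hm (i) : (P (o i) : ℤ) = 2 * m i := by
    obtain ⟨a, ha⟩ := heven (o i)
    simp only [m]
    omega
  let ex (j : ℕ) (b : Bool) : ℤ := if b then j else -1 - j
  let Φ (p : (Σ i, Fin (m i)) × Bool) : V := (ρ ^ ex p.1.2 p.2) (o p.1.1)
  have hstep (n : ℤ) (x : V) : ρ ((ρ ^ n) x) = (ρ ^ (n + 1)) x := by
    rw [add_comm, zpow_add, zpow_one, Equiv.Perm.mul_apply]
  have hcongr (n n' : ℤ) (x : V) : (ρ ^ n) x = (ρ ^ n') x ↔ (P x : ℤ) ∣ n - n' := by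
    rw [← hP, ← (ρ ^ (-n')).apply_eq_iff_eq, ← Equiv.Perm.mul_apply, ← Equiv.Perm.mul_apply,
      ← zpow_add, ← zpow_add, neg_add_cancel, zpow_zero, Equiv.Perm.one_apply, neg_add_eq_sub]
  have hbij : Function.Bijective Φ := by
    constructor
    · rintro ⟨⟨i, j⟩, b⟩ ⟨⟨i', j'⟩, b'⟩ h
      simp only [Φ] at h
      obtain rfl : i = i' := ho' (by
        have h1 : ρ.SameCycle (o i) ((ρ ^ ex j b) (o i)) := ⟨_, rfl⟩
        have h2 : ρ.SameCycle (o i') ((ρ ^ ex j' b') (o i')) := ⟨_, rfl⟩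
        rw [h] at h1
        exact h1.trans h2.symm)
      rw [hcongr, hm] at h
      obtain ⟨d, hd⟩ := h
      have hj := j.isLt
      have hj' := j'.isLt
      have hd0 : d = 0 := by
        have hlt : -(2 * (m i : ℤ)) < 2 * m i * d ∧ 2 * (m i : ℤ) * d < 2 * m i := by
          rw [← hd]; simp only [ex]; split_ifs <;> constructor <;> omega
        have h1 : -1 < d := by nlinarith
        have h2 : d < 1 := by nlinarith
        omega
      rw [hd0, mul_zero] at hd
      have : (j : ℕ) = j' ∧ b = b' := by
        cases b <;> cases b' <;> simp [ex] at hd ⊢ <;> omega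
      obtain ⟨h1, rfl⟩ := this
      rw [Fin.ext h1]
    · intro x
      obtain ⟨i, n, rfl⟩ := ho x
      have hm0 : (0 : ℤ) < 2 * m i := by have := hpos (o i); have := hm i; omega
      have h0 := Int.emod_nonneg n hm0.ne'
      have h1 := Int.emod_lt_of_pos n hm0
      have h2 := Int.mul_ediv_add_emod n (2 * m i)
      by_cases hlt : n % (2 * m i) < m i
      · refine ⟨(⟨i, ⟨(n % (2 * m i)).toNat, by omega⟩⟩, true), ?_⟩
        simp only [Φ, hcongr, hm]
        refine ⟨-(n / (2 * m i)), ?_⟩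
        simp only [ex, if_true, mul_neg]
        omega
      · refine ⟨(⟨i, ⟨(2 * m i - 1 - n % (2 * m i)).toNat, by omega⟩⟩, false), ?_⟩
        simp only [Φ, hcongr, hm]
        refine ⟨-(n / (2 * m i)) - 1, ?_⟩
        simp only [ex, Bool.false_eq_true, if_false, mul_sub, mul_neg]
        omega
  refine ⟨_, m, Equiv.ofBijective Φ hbij, fun i => hfour _, fun i j j' h => ⟨?_, ?_⟩,
    fun i j h => ?_, fun i j h => ?_⟩ <;>
    simp only [Equiv.ofBijective_apply, Φ, hstep, hcongr, hm, ex, if_true, Bool.false_eq_true,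
      if_false]
  · exact ⟨0, by omega⟩
  · exact ⟨0, by omega⟩
  · exact ⟨1, by omega⟩
  · exact ⟨0, by omega⟩

theorem nonempty_ladderBoundary_iso {V W : Type*} (c : Equiv.Perm W) (hc : ∀ x, c x ≠ x)
    (st : W → Bool) (F : SimpleGraph V) (ρ : Equiv.Perm V)
    (hF : ∀ x y, F.Adj x y ↔ ρ x = y ∨ ρ y = x) (Ψ : W × Bool ≃ V)
    (ht : ∀ x, ρ (Ψ (x, true)) = if st (c x) then Ψ (x, false) else Ψ (c x, true))
    (hf : ∀ x, ρ (Ψ (c x, false)) = if st (c x) then Ψ (c x, true) else Ψ (x, false)) :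
    Nonempty (ladderBoundary c hc st ≃g F) := by
  have hff (x y) : ρ (Ψ (x, false)) = Ψ (y, false) ↔ c y = x ∧ st x = false := by
    obtain ⟨x, rfl⟩ := c.surjective x
    rw [hf]
    cases h : st (c x) <;> simp [eq_comm]
  have htt (x y) : ρ (Ψ (x, true)) = Ψ (y, true) ↔ c x = y ∧ st y = false := by
    rw [ht]
    cases h : st (c x) <;> simp <;> rintro rfl <;> simp [h]
  have htf (x y) : ρ (Ψ (x, true)) = Ψ (y, false) ↔ x = y ∧ st (c x) = true := by
    rw [ht]
    cases h : st (c x) <;> simp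
  have hft (x y) : ρ (Ψ (x, false)) = Ψ (y, true) ↔ x = y ∧ st x = true := by
    obtain ⟨x, rfl⟩ := c.surjective x
    rw [hf]
    cases h : st (c x) <;> simp
  refine ⟨⟨Ψ, ?_⟩⟩
  rintro ⟨x, _ | _⟩ ⟨y, _ | _⟩ <;>
    simp only [hF, hff, htt, htf, hft, ladderBoundary, ne_eq, not_true, not_false_iff, true_and,
      false_and, or_false, false_or, reduceCtorEq]
  · exact or_comm
  · constructor
    · rintro (⟨rfl, h⟩ | ⟨rfl, h⟩)
      · exact ⟨rfl, Or.inl h⟩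
      · exact ⟨rfl, Or.inr h⟩
    · rintro ⟨rfl, h | h⟩
      · exact Or.inl ⟨rfl, h⟩
      · exact Or.inr ⟨rfl, h⟩
  · constructor
    · rintro (⟨rfl, h⟩ | ⟨rfl, h⟩)
      · exact ⟨rfl, Or.inr h⟩
      · exact ⟨rfl, Or.inl h⟩
    · rintro ⟨rfl, h | h⟩
      · exact Or.inr ⟨rfl, h⟩
      · exact Or.inl ⟨rfl, h⟩

/-- Häggkvist's lemma: the doubling of the cycle `C_{2r+1}` decomposes into two copies of any
bipartite 2-regular graph of order `2 (2r+1)`. -/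
theorem exists_doubled_cycle_decomposition {V : Type*} [Finite V] {r : ℕ} (hr : 1 ≤ r)
    (hV : Nat.card V = 2 * (2 * r + 1)) (F : SimpleGraph V)
    (h2 : ∀ x, (F.neighborSet x).ncard = 2) (hbip : F.Colorable 2) :
    ∃ H : Bool → SimpleGraph (Fin (2 * r + 1) × Bool), (∀ t, Nonempty (H t ≃g F)) ∧
      (∀ p q, (∃ t, (H t).Adj p q) ↔
        (finRotate _ p.1 = q.1 ∨ finRotate _ q.1 = p.1)) ∧
      ∀ p q t t', (H t).Adj p q → (H t').Adj p q → t = t' := by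
  obtain ⟨ρ, col, hF, hcol, hρ⟩ := exists_perm_of_two_regular F h2 hbip
  obtain ⟨k, m, Φ, hm, hΦ1, hΦ2, hΦ3⟩ := exists_ladder_coordinates ρ col hcol hρ
  have hsum : ∑ i, m i = 2 * r + 1 := by
    have := Nat.card_congr Φ
    rw [hV, Nat.card_prod, Nat.card_sigma] at this
    simp at this
    omega
  let e : (Σ i, Fin (m i)) ≃ Fin (2 * r + 1) := finSigmaFinEquiv.trans (finCongr hsum)
  let c : Equiv.Perm (Fin (2 * r + 1)) := finRotate _
  have hcc (x) : c (c x) ≠ x := finRotate_finRotate_ne (by omega) x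
  have hc (x) : c x ≠ x := fun h => hcc x (by rw [h, h])
  have he (i) (j j' : Fin (m i)) (h : (j' : ℕ) = j + 1) : c (e ⟨i, j⟩) = e ⟨i, j'⟩ := by
    have hval : (e ⟨i, j'⟩ : ℕ) = e ⟨i, j⟩ + 1 := by
      simp [e, finSigmaFinEquiv_apply, h, add_assoc]
    refine Fin.ext ?_
    have := (e ⟨i, j'⟩).isLt
    rw [val_finRotate, hval, if_neg (by omega)]
  let st (x) : Bool := decide (((e.symm x).2 : ℕ) = 0)
  let par (x) : Bool := decide (((e.symm x).2 : ℕ) % 2 = 0)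
  have hst (i) (j : Fin (m i)) : st (e ⟨i, j⟩) = decide ((j : ℕ) = 0) :=
    congrArg (fun z : Σ i, Fin (m i) => decide ((z.2 : ℕ) = 0)) (e.symm_apply_apply _)
  have hpar (i) (j : Fin (m i)) : par (e ⟨i, j⟩) = decide ((j : ℕ) % 2 = 0) :=
    congrArg (fun z : Σ i, Fin (m i) => decide ((z.2 : ℕ) % 2 = 0)) (e.symm_apply_apply _)
  have hpred (x) (h : st (c x) = false) : ∃ (i : Fin k) (j j' : Fin (m i)), (j' : ℕ) = j + 1 ∧
      x = e ⟨i, j⟩ ∧ c x = e ⟨i, j'⟩ := by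
    obtain ⟨⟨i, j'⟩, hy⟩ := e.surjective (c x)
    rw [← hy, hst, decide_eq_false_iff_not] at h
    have hlt : (j' : ℕ) - 1 < m i := by omega
    have hj : (j' : ℕ) = (⟨(j' : ℕ) - 1, hlt⟩ : Fin (m i)) + 1 := by simp; omega
    refine ⟨i, ⟨j' - 1, hlt⟩, j', hj, ?_, hy.symm⟩
    exact c.injective (by rw [he i _ _ hj, hy])
  have hlast (i) (j : Fin (m i)) (h : st (c (e ⟨i, j⟩)) = true) : (j : ℕ) + 1 = m i := by
    by_contra hne
    have hlt : (j : ℕ) + 1 < m i := by omega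
    rw [he i j ⟨j + 1, hlt⟩ rfl, hst] at h
    simp at h
  let Ψ : Fin (2 * r + 1) × Bool ≃ V := (Equiv.prodCongrLeft fun _ => e.symm).trans Φ
  have hΨ (z b) : Ψ (e z, b) = Φ (z, b) := by
    simp [Ψ]
  have ht (x) : ρ (Ψ (x, true)) = if st (c x) then Ψ (x, false) else Ψ (c x, true) := by
    split_ifs with h
    · obtain ⟨⟨i, j⟩, rfl⟩ := e.surjective x
      rw [hΨ, hΨ]
      exact hΦ2 i j (hlast i j h)
    · obtain ⟨i, j, j', hj, rfl, hy⟩ := hpred x (by simpa using h)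
      rw [hy, hΨ, hΨ]
      exact (hΦ1 i j j' hj).1
  have hf (x) : ρ (Ψ (c x, false)) = if st (c x) then Ψ (c x, true) else Ψ (x, false) := by
    split_ifs with h
    · obtain ⟨⟨i, j⟩, hy⟩ := e.surjective (c x)
      rw [← hy] at h ⊢
      rw [hΨ, hΨ]
      rw [hst, decide_eq_true_eq] at h
      exact hΦ3 i j h
    · obtain ⟨i, j, j', hj, rfl, hy⟩ := hpred x (by simpa using h)
      rw [hy, hΨ, hΨ]
      exact (hΦ1 i j j' hj).2
  have hiso := nonempty_ladderBoundary_iso c hc st F ρ hF Ψ ht hf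
  refine ⟨haggkvistFactor c hc st, fun t => ?_, ?_, ?_⟩
  · obtain ⟨φ⟩ := hiso
    have hst' (x) (hx : st x = true) : st (c x) = false := by
      by_contra h
      obtain ⟨⟨i, j⟩, rfl⟩ := e.surjective x
      have := hlast i j (by simpa using h)
      rw [hst, decide_eq_true_eq] at hx
      have := hm i
      omega
    have hpar' (x) (hx : st x = true) : par x = true := by
      obtain ⟨⟨i, j⟩, rfl⟩ := e.surjective x
      rw [hst, decide_eq_true_eq] at hx
      simp [hpar, hx]
    have hparc (x) (hx : st (c x) = false) : par (c x) = !par x := by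
      obtain ⟨i, j, j', hj, rfl, hy⟩ := hpred x hx
      rw [hy, hpar, hpar, ← decide_not, decide_eq_decide]
      omega
    obtain ⟨φ'⟩ := nonempty_haggkvistFactor_iso c hc st par hst' hpar' hparc t
    exact ⟨φ'.trans φ⟩
  · intro p q
    constructor
    · rintro ⟨t, h | h⟩
      · exact Or.inl h.1
      · exact Or.inr h.1
    · rintro (h | h)
      · exact ⟨_, Or.inl ⟨h, rfl⟩⟩
      · exact ⟨_, Or.inr ⟨h, rfl⟩⟩
  · rintro p q t t' (⟨h, rfl⟩ | ⟨h, rfl⟩) (⟨h', rfl⟩ | ⟨h', rfl⟩)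
    · rfl
    · exact (hcc _ (by rw [h, h'])).elim
    · exact (hcc _ (by rw [h, h'])).elim
    · rfl

/-- let `v ≡ 2 (mod 4)` and let `F_1, …, F_t` be bipartite 2-regular
graphs of order `v`, with nonnegative even multiplicities `α_1, …, α_t` summing to
`(v-2)/2`.  Then there is a perfect matching `I` of `K_v` and a 2-factorization of
`K_v - I` containing exactly `α i` factors isomorphic to `F i` for each `i`. -/
theorem stmt_17 (v : ℕ) (hv : v % 4 = 2) (t : ℕ)
    (F : Fin t → SimpleGraph (Fin v))
    (h2 : ∀ i, ∀ x : Fin v, ((F i).neighborSet x).ncard = 2)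
    (hbip : ∀ i, (F i).Colorable 2)
    (α : Fin t → ℕ) (heven : ∀ i, Even (α i))
    (hsum : ∑ i, α i = (v - 2) / 2) :
    ∃ (I : SimpleGraph (Fin v))
      (G : (i : Fin t) → Fin (α i) → SimpleGraph (Fin v)),
      (∀ x : Fin v, (I.neighborSet x).ncard = 1) ∧
      (∀ i j, Nonempty (G i j ≃g F i)) ∧
      (∀ (i : Fin t) (j : Fin (α i)) (i' : Fin t) (j' : Fin (α i')),
        (⟨i, j⟩ : Σ i : Fin t, Fin (α i)) ≠ ⟨i', j'⟩ →
        Disjoint ((G i j).edgeSet) ((G i' j').edgeSet)) ∧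
      (⨆ i, ⨆ j, G i j) = (⊤ \ I : SimpleGraph (Fin v)) := by
  obtain ⟨r, rfl⟩ : ∃ r, v = 2 * (2 * r + 1) := ⟨v / 4, by omega⟩
  choose β hβ using heven
  have hβsum : ∑ i, β i = r := by
    have : ∑ i, α i = ∑ i, β i + ∑ i, β i := by
      rw [← Finset.sum_add_distrib]; exact Finset.sum_congr rfl fun i _ => hβ i
    omega
  have hr (i : Fin t) : 1 ≤ r := by
    by_contra hr0
    obtain rfl : r = 0 := by omega
    obtain ⟨a, b, hab, hs⟩ := Set.ncard_eq_two.1 (h2 i ⟨0, by omega⟩)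
    have ha : (F i).Adj ⟨0, by omega⟩ a := by
      rw [← SimpleGraph.mem_neighborSet, hs]; simp
    have hb : (F i).Adj ⟨0, by omega⟩ b := by
      rw [← SimpleGraph.mem_neighborSet, hs]; simp
    have ha := ha.ne
    have hb := hb.ne
    simp only [ne_eq, Fin.ext_iff] at ha hb hab
    omega
  choose H hHF hH hHdisj using fun i =>
    exists_doubled_cycle_decomposition (hr i) (by simp) (F i) (h2 i) (hbip i)
  obtain ⟨h, hh⟩ := exists_hamiltonian_decomposition r
  let s : (Σ i, Fin (β i)) ≃ Fin r := finSigmaFinEquiv.trans (finCongr hβsum)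
  let half (i : Fin t) (j : Fin (α i)) : Fin (β i) :=
    ⟨j / 2, by have := j.isLt; have := hβ i; omega⟩
  let bit (i : Fin t) (j : Fin (α i)) : Bool := decide ((j : ℕ) % 2 = 0)
  let E : Fin (2 * (2 * r + 1)) ≃ Fin (2 * r + 1) × Bool :=
    Fintype.equivOfCardEq (by simp [mul_comm])
  let pos (i : Fin t) (j : Fin (α i)) : Fin (2 * (2 * r + 1)) ≃ Fin (2 * r + 1) × Bool :=
    E.trans (Equiv.prodCongrLeft fun _ => h (s ⟨i, half i j⟩))
  have hpos (i j x) : (pos i j x).1 = h (s ⟨i, half i j⟩) (E x).1 := rfl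
  let G (i : Fin t) (j : Fin (α i)) : SimpleGraph (Fin (2 * (2 * r + 1))) :=
    (H i (bit i j)).comap (pos i j)
  have hG (i j x y) (hxy : (G i j).Adj x y) :
      finRotate _ (h (s ⟨i, half i j⟩) (E x).1) = h (s ⟨i, half i j⟩) (E y).1 ∨
        finRotate _ (h (s ⟨i, half i j⟩) (E y).1) = h (s ⟨i, half i j⟩) (E x).1 :=
    (hH i (pos i j x) (pos i j y)).1 ⟨_, hxy⟩
  have hGne (i j x y) (hxy : (G i j).Adj x y) : (E x).1 ≠ (E y).1 := by
    intro he
    have := hG i j x y hxy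
    rw [he, or_self] at this
    have hr := hr i
    exact finRotate_finRotate_ne (n := 2 * r) (by omega) _ (by rw [this, this])
  let I : SimpleGraph (Fin (2 * (2 * r + 1))) :=
    { Adj := fun x y => (E x).1 = (E y).1 ∧ (E x).2 ≠ (E y).2
      symm := ⟨fun _ _ h => ⟨h.1.symm, h.2.symm⟩⟩
      loopless := ⟨fun _ h => h.2 rfl⟩ }
  have hI (x y) (hxy : x ≠ y) : I.Adj x y ↔ (E x).1 = (E y).1 :=
    ⟨fun h => h.1, fun h => ⟨h, fun h' => hxy (E.injective (Prod.ext h h'))⟩⟩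
  refine ⟨I, G, fun x => ?_, fun i j => ?_, fun i j i' j' hne => ?_, ?_⟩
  · rw [Set.ncard_eq_one]
    refine ⟨E.symm ((E x).1, !(E x).2), ?_⟩
    ext y
    rw [SimpleGraph.mem_neighborSet, Set.mem_singleton_iff, Equiv.eq_symm_apply, Prod.ext_iff]
    change (E x).1 = (E y).1 ∧ (E x).2 ≠ (E y).2 ↔ _
    refine and_congr eq_comm ?_
    cases (E x).2 <;> cases (E y).2 <;> simp
  · obtain ⟨φ⟩ := hHF i (bit i j)
    exact ⟨(SimpleGraph.Iso.comap (pos i j) _).trans φ⟩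
  · rw [Set.disjoint_left]
    intro w hw hw'
    induction w with | h x y => ?_
    rw [SimpleGraph.mem_edgeSet] at hw hw'
    have hs : s ⟨i, half i j⟩ = s ⟨i', half i' j'⟩ :=
      (hh (E x).1 (E y).1 (hGne i j x y hw)).unique (hG i j x y hw) (hG i' j' x y hw')
    have hs := s.injective hs
    obtain rfl : i = i' := congrArg Sigma.fst hs
    have hhalf : half i j = half i j' := by simpa using hs
    have hpp : pos i j' = pos i j := by simp only [pos, hhalf]
    change (H i (bit i j')).Adj (pos i j' x) (pos i j' y) at hw'
    rw [hpp] at hw'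
    have hbit := hHdisj i _ _ _ _ hw hw'
    apply hne
    have : j = j' := by
      have h1 : (j : ℕ) / 2 = j' / 2 := congrArg Fin.val hhalf
      simp only [bit, decide_eq_decide] at hbit
      omega
    rw [this]
  · ext x y
    simp only [SimpleGraph.iSup_adj, SimpleGraph.sdiff_adj, SimpleGraph.top_adj]
    constructor
    · rintro ⟨i, j, hij⟩
      refine ⟨hij.ne, fun hxy => hGne i j x y hij hxy.1⟩
    · rintro ⟨hne, hxy⟩
      rw [hI x y hne] at hxy
      obtain ⟨s₀, hs₀, -⟩ := hh _ _ hxy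
      obtain ⟨⟨i, l⟩, rfl⟩ := s.surjective s₀
      obtain ⟨b, hb⟩ := (hH i (h (s ⟨i, l⟩) (E x).1, (E x).2)
        (h (s ⟨i, l⟩) (E y).1, (E y).2)).2 hs₀
      have hl : 2 * (l : ℕ) + (if b then 0 else 1) < α i := by
        have := hβ i; have := l.isLt; split_ifs <;> omega
      have hhalf : half i ⟨_, hl⟩ = l := by
        refine Fin.ext ?_
        simp only [half]
        split_ifs <;> omega
      have hbit : bit i ⟨_, hl⟩ = b := by
        cases b <;> simp [bit]
      refine ⟨i, ⟨_, hl⟩, ?_⟩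
      change (H i (bit i ⟨_, hl⟩)).Adj
        (h (s ⟨i, half i ⟨_, hl⟩⟩) (E x).1, (E x).2) (h (s ⟨i, half i ⟨_, hl⟩⟩) (E y).1, (E y).2)
      rw [hhalf, hbit]
      exact hb
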